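/- Let P be a Wait-Only protocol with uncoverable state q_u and final state q_f ∈ Q_A, and let V_P be the associated modified VASS. Then there exist an initial configuration C of P and a configuration C' such that C →* C' and C'(e) = q_f for all e ∈ [1, ||C'||], if and only if there is a run (s_0, 0) ⇝* (s_f, 0) and a run (s_f, 0) ⇝* (s_0, 0) in V_P. -/

import Mathlib

set_option maxHeartbeats 1000000

inductive Act (M : Type) where
  | send : M → Act M
  | recv : M → Act M

structure Protocol (Q M : Type) where
  qin : Q
  T : Set (Q × Act M × Q)

namespace Protocol

variable {Q M : Type}

/-- Messages receivable from state `q`. -/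
def R (P : Protocol Q M) (q : Q) : Set M := {a | ∃ q', (q, Act.recv a, q') ∈ P.T}

/-- `q` has an outgoing reception transition. -/
def isWaiting (P : Protocol Q M) (q : Q) : Prop := ∃ a q', (q, Act.recv a, q') ∈ P.T

/-- The set of waiting states. -/
def QW (P : Protocol Q M) : Set Q := {q | P.isWaiting q}

/-- The set of action states. -/
def QA (P : Protocol Q M) : Set Q := {q | ¬ P.isWaiting q}

/-- Wait-Only protocol: every state has no receptions or no broadcasts; the initial
state is an action state; there is no broadcast self-loop. -/
def WaitOnly (P : Protocol Q M) : Prop :=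
  (∀ q : Q, ¬ P.isWaiting q ∨ ¬ ∃ a q', (q, Act.send a, q') ∈ P.T) ∧
  ¬ P.isWaiting P.qin ∧
  ∀ q a, (q, Act.send a, q) ∉ P.T

/-- `qu` is an uncoverable state. -/
def Uncoverable (P : Protocol Q M) (qu : Q) : Prop :=
  (∀ q α q', (q, α, q') ∈ P.T → q ≠ qu ∧ q' ≠ qu) ∧ qu ≠ P.qin

/-- One broadcast step, performed by process `e` via transition `t`. -/
def Step (P : Protocol Q M) {n : ℕ} (e : Fin n) (t : Q × Act M × Q) (C C' : Fin n → Q) : Prop :=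
  ∃ q a q', t = (q, Act.send a, q') ∧ t ∈ P.T ∧ C e = q ∧ C' e = q' ∧
    ∀ e' : Fin n, e' ≠ e →
      ((C e', Act.recv a, C' e') ∈ P.T ∨ (a ∉ P.R (C e') ∧ C' e' = C e'))

def StepAny (P : Protocol Q M) {n : ℕ} (C C' : Fin n → Q) : Prop :=
  ∃ e t, P.Step e t C C'

def Reach (P : Protocol Q M) {n : ℕ} : (Fin n → Q) → (Fin n → Q) → Prop :=
  Relation.ReflTransGen P.StepAny

def Initial (P : Protocol Q M) {n : ℕ} (C : Fin n → Q) : Prop := ∀ e, C e = P.qin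

end Protocol

/-- A finite or infinite execution: `len` is the number of configurations (`⊤` = infinite);
configurations beyond the length are irrelevant. -/
structure Exec {Q M : Type} (P : Protocol Q M) (n : ℕ) where
  npos : 0 < n
  len : ℕ∞
  len_pos : 1 ≤ len
  conf : ℕ → Fin n → Q
  init : P.Initial (conf 0)
  step : ∀ i : ℕ, ((i : ℕ∞) + 1) < len → P.StepAny (conf i) (conf (i + 1))

namespace Exec

variable {Q M : Type} {P : Protocol Q M} {n : ℕ}

open Classical in
/-- First moment `k ≥ j` (within the execution) at which process `e` is in an action
state; `|ρ|` if there is none. -/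
noncomputable def nextIdx (ρ : Exec P n) (j : ℕ) (e : Fin n) : ℕ∞ :=
  if h : ∃ k : ℕ, j ≤ k ∧ (k : ℕ∞) < ρ.len ∧ ¬ P.isWaiting (ρ.conf k e)
  then (Nat.find h : ℕ∞)
  else ρ.len

open Classical in
/-- The next action state of process `e` after `j`; the uncoverable state `qu` if none. -/
noncomputable def nextSt (qu : Q) (ρ : Exec P n) (j : ℕ) (e : Fin n) : Q :=
  if h : ∃ k : ℕ, j ≤ k ∧ (k : ℕ∞) < ρ.len ∧ ¬ P.isWaiting (ρ.conf k e)
  then ρ.conf (Nat.find h) e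
  else qu

noncomputable def next (qu : Q) (ρ : Exec P n) (j : ℕ) (e : Fin n) : Q × ℕ∞ :=
  (nextSt qu ρ j e, nextIdx ρ j e)

/-- Well-formed executions. -/
def WellFormed (qu : Q) (ρ : Exec P n) : Prop :=
  ∀ i : ℕ, (i : ℕ∞) < ρ.len → ∀ e1 e2 : Fin n,
    ρ.conf i e1 = ρ.conf i e2 → P.isWaiting (ρ.conf i e1) →
    nextSt qu ρ i e1 = nextSt qu ρ i e2 →
    ∀ k : ℕ, i ≤ k → (k : ℕ∞) ≤ nextIdx ρ i e1 → ρ.conf k e1 = ρ.conf k e2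

/-- The set of indices at which some process currently waiting will reach action state `qa`. -/
def nextSet (qu : Q) (ρ : Exec P n) (j : ℕ) (qa : Q) : Set ℕ :=
  {i | ∃ e : Fin n, P.isWaiting (ρ.conf j e) ∧ next qu ρ j e = (qa, (i : ℕ∞))}

end Exec

structure VASS (L X : Type) where
  init : L
  Δ : Set (L × (X → ℤ) × L)

namespace VASS

variable {L X : Type}

/-- One VASS step (counters stay in ℕ by typing). -/
def Step (V : VASS L X) (c c' : L × (X → ℕ)) : Prop :=
  ∃ δ, (c.1, δ, c'.1) ∈ V.Δ ∧ ∀ x, (c'.2 x : ℤ) = (c.2 x : ℤ) + δ x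

def Reach (V : VASS L X) : (L × (X → ℕ)) → (L × (X → ℕ)) → Prop :=
  Relation.ReflTransGen V.Step

end VASS

/-- A summary: a print (set of waiting states), an exit state and an identifier. -/
structure Summary (Q : Type) where
  pr : Set Q
  exit : Q
  id : ℕ

namespace BP

variable {Q M : Type}

/-- `|Q_W|`. -/
noncomputable def nW (P : Protocol Q M) : ℕ := P.QW.ncard

def ValidSummary (P : Protocol Q M) (S : Summary Q) : Prop :=
  S.pr ⊆ P.QW ∧ S.exit ∈ P.QA ∧ 1 ≤ S.id ∧ S.id ≤ nW P + 1

/-- Coherent sets of summaries. -/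
def Coherent (P : Protocol Q M) (SS : Set (Summary Q)) : Prop :=
  (∀ S ∈ SS, ValidSummary P S) ∧
  ∀ S1 ∈ SS, ∀ S2 ∈ SS, S1 ≠ S2 → S1.exit = S2.exit →
    S1.id ≠ S2.id ∧ S1.pr ∩ S2.pr = ∅

/-- Labels of a set of summaries. -/
def labs (SS : Set (Summary Q)) : Set (Q × ℕ) := (fun S => (S.exit, S.id)) '' SS

/-- `σ` describes a legal reaction of each state of `pr` to the broadcast of `b`. -/
def RecvFun (P : Protocol Q M) (b : M) (pr : Set Q) (σ : Q → Q) : Prop :=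
  ∀ p ∈ pr, (p, Act.recv b, σ p) ∈ P.T ∨ (b ∉ P.R p ∧ σ p = p)

/-- `S ⟶^t S'`. -/
def SummStep (P : Protocol Q M) (t : Q × Act M × Q) (S S' : Summary Q) : Prop :=
  ∃ q b q', t = (q, Act.send b, q') ∧ t ∈ P.T ∧
    ∃ σ : Q → Q, RecvFun P b S.pr σ ∧ S'.exit = S.exit ∧ S'.id = S.id ∧
      S'.pr = σ '' S.pr ∧ σ '' S.pr ⊆ P.QW

/-- `S ⟶^{t,+q'} S'`. -/
def SummStepJoin (P : Protocol Q M) (t : Q × Act M × Q) (S S' : Summary Q) : Prop :=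
  ∃ q b q', t = (q, Act.send b, q') ∧ t ∈ P.T ∧ q' ∈ P.QW ∧
    ∃ σ : Q → Q, RecvFun P b S.pr σ ∧ S'.exit = S.exit ∧ S'.id = S.id ∧
      S'.pr = σ '' S.pr ∪ {q'} ∧ σ '' S.pr ∪ {q'} ⊆ P.QW

/-- `S ⟶^t Done`. -/
def SummStepDone (P : Protocol Q M) (t : Q × Act M × Q) (S : Summary Q) : Prop :=
  ∃ q b q', t = (q, Act.send b, q') ∧ t ∈ P.T ∧
    ∃ σ : Q → Q, RecvFun P b S.pr σ ∧ σ '' S.pr = {S.exit}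

/-- `S` steps to `some S'` or to `Done` (encoded as `none`). -/
def stepsTo (P : Protocol Q M) (t : Q × Act M × Q) (S : Summary Q) :
    Option (Summary Q) → Prop
  | some S' => SummStep P t S S'
  | none => SummStepDone P t S

inductive CtrBase (Q : Type) where
  | st : Q → CtrBase Q
  | sm : Q → ℕ → CtrBase Q

def ValidCtr (P : Protocol Q M) : CtrBase Q → Prop
  | .st q => q ∈ P.QA
  | .sm q k => q ∈ P.QA ∧ 1 ≤ k ∧ k ≤ nW P + 1

/-- The counters of the VASS built from `P`. -/
abbrev Ctr (P : Protocol Q M) := {x : CtrBase Q // ValidCtr P x}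

open Classical in
/-- Characteristic (unit) vector of a counter. -/
noncomputable def chi (P : Protocol Q M) (x : CtrBase Q) : Ctr P → ℤ :=
  fun y => if y.val = x then 1 else 0

/-- The relation `(SS, δ, SS') ∈ Δ_t`. -/
def DeltaT (P : Protocol Q M) (t : Q × Act M × Q) (SS : Set (Summary Q))
    (δ : Ctr P → ℤ) (SS' : Set (Summary Q)) : Prop :=
  Coherent P SS ∧ Coherent P SS' ∧
  ∃ q a q', t = (q, Act.send a, q') ∧ t ∈ P.T ∧
  ((q' ∈ P.QA ∧
      (∃ g : Summary Q → Option (Summary Q),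
        (∀ S ∈ SS, stepsTo P t S (g S)) ∧
        SS' = {S' | ∃ S ∈ SS, g S = some S'}) ∧
      δ = fun y => chi P (.st q') y - chi P (.st q) y) ∨
   (q' ∈ P.QW ∧
      ∃ S0 ∈ SS, ∃ S0' : Summary Q, SummStepJoin P t S0 S0' ∧
      (∃ g : Summary Q → Option (Summary Q),
        (∀ S ∈ SS, S ≠ S0 → stepsTo P t S (g S)) ∧
        SS' = insert S0' {S' | ∃ S ∈ SS, S ≠ S0 ∧ g S = some S'}) ∧
      δ = fun y => chi P (.sm S0.exit S0.id) y - chi P (.st q) y) ∨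
   (q' ∈ P.QW ∧
      ∃ qa ∈ P.QA, ∃ k : ℕ, 1 ≤ k ∧ k ≤ nW P + 1 ∧ (qa, k) ∉ labs SS ∧
      (∃ g : Summary Q → Option (Summary Q),
        (∀ S ∈ SS, stepsTo P t S (g S)) ∧
        SS' = insert (Summary.mk {q'} qa k) {S' | ∃ S ∈ SS, g S = some S'}) ∧
      δ = fun y => chi P (.sm qa k) y - chi P (.st q) y))

/-- The relation `(SS, δ, SS) ∈ Δ_e`. -/
def DeltaE (P : Protocol Q M) (SS : Set (Summary Q)) (δ : Ctr P → ℤ) : Prop :=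
  Coherent P SS ∧ ∃ q ∈ P.QA, ∃ k : ℕ, 1 ≤ k ∧ k ≤ nW P + 1 ∧ (q, k) ∉ labs SS ∧
    δ = fun y => chi P (.st q) y - chi P (.sm q k) y

/-- Locations of the VASS `V_P` (final state a waiting state). -/
inductive LocW (Q : Type) where
  | s0 : LocW Q
  | sf : LocW Q
  | co : Set (Summary Q) → LocW Q

/-- The VASS `V_P` associated to `P`, `q_u`, and a final waiting state `q_f`. -/
noncomputable def VP (P : Protocol Q M) (qu qf : Q) : VASS (LocW Q) (Ctr P) where
  init := .s0
  Δ := {d |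
    d = (.s0, chi P (.st P.qin), .s0) ∨
    d = (.s0, 0, .co ∅) ∨
    d = (LocW.co {Summary.mk {qf} qu 1}, 0, .sf) ∨
    d = (.sf, fun y => -(chi P (.sm qu 1) y), .sf) ∨
    (∃ t SS δ SS', d = (.co SS, δ, .co SS') ∧ DeltaT P t SS δ SS') ∨
    (∃ SS δ, d = (.co SS, δ, .co SS) ∧ DeltaE P SS δ)}

/-- `C ∈ ⟦(SS, v)⟧`. -/
def Implements (P : Protocol Q M) (SS : Set (Summary Q)) (v : Ctr P → ℕ)
    {n : ℕ} (C : Fin n → Q) : Prop :=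
  ∃ f : Fin n → Ctr P,
    (∀ x : Ctr P, {e : Fin n | f e = x}.ncard = v x) ∧
    (∀ e q, (f e).val = CtrBase.st q → C e = q) ∧
    (∀ e q k pr, (f e).val = CtrBase.sm q k → Summary.mk pr q k ∈ SS → C e ∈ pr ∪ {q}) ∧
    (∀ e q k, (f e).val = CtrBase.sm q k → (q, k) ∉ labs SS → C e = q)

end BP


namespace BP

variable {Q M : Type}

/-- Locations of the modified VASS `V_P` (final state an action state). -/
inductive LocA (Q : Type) where
  | s0 : LocA Q
  | sf' : LocA Q
  | sf : LocA Q
  | co : Set (Summary Q) → LocA Q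

/-- The modified VASS `V_P` associated to `P` and a final action state `q_f`. -/
noncomputable def VPA (P : Protocol Q M) (qf : Q) : VASS (LocA Q) (Ctr P) where
  init := .s0
  Δ := {d |
    d = (.s0, chi P (.st P.qin), .s0) ∨
    d = (.s0, 0, .co ∅) ∨
    d = (LocA.co ∅, fun y => -(chi P (.st qf) y), .sf') ∨
    d = (.sf', chi P (.st qf), .sf) ∨
    d = (.sf, fun y => -(chi P (.st qf) y), .sf) ∨
    d = (.sf, 0, .s0) ∨
    (∃ t SS δ SS', d = (.co SS, δ, .co SS') ∧ DeltaT P t SS δ SS') ∨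
    (∃ SS δ, d = (.co SS, δ, .co SS) ∧ DeltaE P SS δ)}

end BP

namespace BP

variable {Q M : Type}

section Configurations

/-- A process in state `p` may react to a broadcast of `b` by moving to `p'`. -/
def React (P : Protocol Q M) (b : M) (p p' : Q) : Prop :=
  (p, Act.recv b, p') ∈ P.T ∨ (b ∉ P.R p ∧ p' = p)

/-- A broadcast step between configurations indexed by an arbitrary type. -/
def StepOn (P : Protocol Q M) {ι : Type} (C C' : ι → Q) : Prop :=
  ∃ e b, (C e, Act.send b, C' e) ∈ P.T ∧ ∀ e', e' ≠ e → React P b (C e') (C' e')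

theorem stepAny_iff_stepOn (P : Protocol Q M) {n : ℕ} (C C' : Fin n → Q) :
    P.StepAny C C' ↔ StepOn P C C' := by
  constructor
  · rintro ⟨e, _, _, b, _, rfl, ht, rfl, rfl, h⟩
    exact ⟨e, b, ht, h⟩
  · rintro ⟨e, b, ht, h⟩
    exact ⟨e, _, _, b, _, rfl, ht, rfl, rfl, h⟩

theorem StepOn.comp_equiv {P : Protocol Q M} {ι κ : Type} {C C' : ι → Q}
    (h : StepOn P C C') (φ : κ ≃ ι) : StepOn P (C ∘ φ) (C' ∘ φ) := by
  obtain ⟨e, b, ht, h⟩ := h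
  refine ⟨φ.symm e, b, by simpa using ht, fun e' he' => h _ fun hh => he' ?_⟩
  simp [← hh]

/-- The configuration `C` together with one more process in state `q`. -/
def addProc {ι : Type} (q : Q) (C : ι → Q) : Option ι → Q := fun o => o.elim q C

theorem react_self_of_not_isWaiting {P : Protocol Q M} {q : Q} (hq : ¬ P.isWaiting q) (b : M) :
    React P b q q :=
  Or.inr ⟨fun ⟨q', h⟩ => hq ⟨b, q', h⟩, rfl⟩

theorem React.eq_of_not_isWaiting {P : Protocol Q M} {b : M} {p p' : Q} (h : React P b p p')
    (hp : ¬ P.isWaiting p) : p' = p := by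
  rcases h with h | h
  · exact absurd ⟨b, p', h⟩ hp
  · exact h.2

theorem StepOn.addProc {P : Protocol Q M} {ι : Type} {C C' : ι → Q}
    (h : StepOn P C C') {q : Q} (hq : ¬ P.isWaiting q) :
    StepOn P (addProc q C) (addProc q C') := by
  obtain ⟨e, b, ht, h⟩ := h
  refine ⟨some e, b, ht, fun e' he' => ?_⟩
  cases e' with
  | none => exact react_self_of_not_isWaiting hq b
  | some e' => exact h e' fun hh => he' (by rw [hh])

theorem _root_.Protocol.WaitOnly.not_isWaiting_of_send {P : Protocol Q M} (hWO : P.WaitOnly)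
    {q q' : Q} {b : M} (h : (q, Act.send b, q') ∈ P.T) : ¬ P.isWaiting q :=
  (hWO.1 q).resolve_right fun hn => hn ⟨b, q', h⟩

end Configurations

section Counting

open Classical in
/-- Number of processes whose token lies on counter `x`. -/
noncomputable def cnt {ι : Type} [Fintype ι] (f : ι → CtrBase Q) (x : CtrBase Q) : ℕ :=
  ∑ e, if f e = x then 1 else 0

/-- The counter valuation of `V_P` given by a token assignment. -/
noncomputable def val (P : Protocol Q M) {ι : Type} [Fintype ι] (f : ι → CtrBase Q) :
    Ctr P → ℕ := fun x => cnt f x.val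

theorem cnt_pos_iff {ι : Type} [Fintype ι] {f : ι → CtrBase Q} {x : CtrBase Q} :
    0 < cnt f x ↔ ∃ e, f e = x := by
  classical
  simp [cnt, Finset.card_pos, Finset.Nonempty]

open Classical in
theorem val_update (P : Protocol Q M) {ι : Type} [Fintype ι]
    (f : ι → CtrBase Q) (e : ι) (y : CtrBase Q) (x : Ctr P) :
    (val P (Function.update f e y) x : ℤ) = val P f x + (chi P y x - chi P (f e) x) := by
  have h1 := Finset.add_sum_erase Finset.univ (fun i => if f i = x.val then (1 : ℤ) else 0)
    (Finset.mem_univ e)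
  have h2 := Finset.add_sum_erase Finset.univ
    (fun i => if Function.update f e y i = x.val then (1 : ℤ) else 0) (Finset.mem_univ e)
  have h3 : ∑ i ∈ Finset.univ.erase e, (if Function.update f e y i = x.val then (1 : ℤ) else 0)
      = ∑ i ∈ Finset.univ.erase e, (if f i = x.val then (1 : ℤ) else 0) := by
    refine Finset.sum_congr rfl fun i hi => ?_
    rw [Function.update_of_ne (Finset.ne_of_mem_erase hi)]
  simp only [val, cnt, chi, Nat.cast_sum, Nat.cast_ite, Nat.cast_one, Nat.cast_zero]
  simp only [Function.update_self, eq_comm (b := x.val)] at h1 h2 h3 ⊢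
  linarith

theorem val_addProc (P : Protocol Q M) {ι : Type} [Fintype ι]
    (f : ι → CtrBase Q) (y : CtrBase Q) (x : Ctr P) :
    (val P (fun o : Option ι => o.elim y f) x : ℤ) = val P f x + chi P y x := by
  classical
  simp only [val, cnt, chi, Fintype.sum_option, Option.elim, eq_comm (b := x.val)]
  push_cast
  ring

end Counting

section Soundness

/-- The part of a transition of `Δ_t` that matters for replaying it in the protocol. -/
theorem DeltaT.exists_replay {P : Protocol Q M} (hWO : P.WaitOnly) {t : Q × Act M × Q}
    {SS SS' : Set (Summary Q)} {δ : Ctr P → ℤ} (h : DeltaT P t SS δ SS') :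
    ∃ q b q', (q, Act.send b, q') ∈ P.T ∧
      (∀ S ∈ SS, ∃ σ : Q → Q, RecvFun P b S.pr σ ∧
        (σ '' S.pr = {S.exit} ∨
          ∃ S' ∈ SS', S'.exit = S.exit ∧ S'.id = S.id ∧ σ '' S.pr ⊆ S'.pr)) ∧
      ∃ y, ValidCtr P y ∧ y ≠ .st q ∧ (δ = fun x => chi P y x - chi P (.st q) x) ∧
        (y = .st q' ∨ ∃ S' ∈ SS', y = .sm S'.exit S'.id ∧ q' ∈ S'.pr) := by
  have key : ∀ {q b q'} {S : Summary Q} {o}, stepsTo P (q, Act.send b, q') S o →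
      (∀ S', o = some S' → S' ∈ SS') → ∃ σ : Q → Q, RecvFun P b S.pr σ ∧
        (σ '' S.pr = {S.exit} ∨
          ∃ S' ∈ SS', S'.exit = S.exit ∧ S'.id = S.id ∧ σ '' S.pr ⊆ S'.pr) := by
    intro q b q' S o ho hmem
    cases o with
    | none =>
      obtain ⟨_, _, _, ⟨⟩, _, σ, h1, h2⟩ := ho
      exact ⟨σ, h1, Or.inl h2⟩
    | some S' =>
      obtain ⟨_, _, _, ⟨⟩, _, σ, h1, h2, h3, h4, _⟩ := ho
      exact ⟨σ, h1, Or.inr ⟨S', hmem S' rfl, h2, h3, h4.ge⟩⟩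
  obtain ⟨hc, -, q, b, q', rfl, ht, h⟩ := h
  refine ⟨q, b, q', ht, ?_⟩
  rcases h with ⟨hq', ⟨g, hg, rfl⟩, rfl⟩ |
    ⟨hq', S0, hS0, S0', ⟨_, _, _, ⟨⟩, _, _, σ, hσ, he, hi, hpr, _⟩, ⟨g, hg, rfl⟩, rfl⟩ |
    ⟨hq', qa, hqa, k, hk1, hk2, hk, ⟨g, hg, rfl⟩, rfl⟩
  · refine ⟨fun S hS => key (hg S hS) fun S' h => ⟨S, hS, h⟩, .st q', hq', ?_, rfl, Or.inl rfl⟩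
    rintro ⟨⟩
    exact hWO.2.2 _ _ ht
  · refine ⟨fun S hS => ?_, .sm S0.exit S0.id, (hc.1 S0 hS0).2, by simp, rfl,
      Or.inr ⟨S0', Set.mem_insert _ _, by rw [he, hi], by simp [hpr]⟩⟩
    by_cases hSS : S = S0
    · subst hSS
      exact ⟨σ, hσ, Or.inr ⟨S0', Set.mem_insert _ _, he, hi, by simp [hpr]⟩⟩
    · exact key (hg S hS hSS) fun S' h => Set.mem_insert_of_mem _ ⟨S, hS, hSS, h⟩
  · exact ⟨fun S hS => key (hg S hS) fun S' h => Set.mem_insert_of_mem _ ⟨S, hS, h⟩,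
      .sm qa k, ⟨hqa, hk1, hk2⟩, by simp, rfl, Or.inr ⟨_, Set.mem_insert _ _, rfl, rfl⟩⟩

/-- The states allowed by the set of summaries `SS` for a process whose token lies on a counter. -/
def Allowed (SS : Set (Summary Q)) : CtrBase Q → Q → Prop
  | .st q, p => p = q
  | .sm q k, p => p = q ∨ ∃ S ∈ SS, S.exit = q ∧ S.id = k ∧ p ∈ S.pr

/-- The set of summaries stored in a location. -/
def LocA.summaries : LocA Q → Set (Summary Q)
  | .co SS => SS
  | _ => ∅

/-- The counter `.sm q_f 0` does not exist in `V_P`: it collects the tokens that were removed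
in the location `s_f`. -/
def SideCondition (qf : Q) {ι : Type} (f : ι → CtrBase Q) : LocA Q → Prop
  | .sf' => ∃ e, f e = .sm qf 0
  | .sf => Nonempty ι
  | _ => True

/-- Some reachable configuration of the protocol is described by the configuration `(ℓ, v)`,
up to additional processes in `q_f`. -/
def Realizable (P : Protocol Q M) (qf : Q) (c : LocA Q × (Ctr P → ℕ)) : Prop :=
  ∃ (ι : Type) (_ : Fintype ι) (C : ι → Q) (f : ι → CtrBase Q),
    Relation.ReflTransGen (StepOn P) (fun _ => P.qin) C ∧
    val P f = c.2 ∧ (∀ e, ValidCtr P (f e) ∨ f e = .sm qf 0) ∧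
    (∀ e, Allowed c.1.summaries (f e) (C e)) ∧ SideCondition qf f c.1

open Classical in
theorem val_eq_of_update {P : Protocol Q M} {ι : Type} [Fintype ι] {f : ι → CtrBase Q}
    {e : ι} {y : CtrBase Q} {v v' : Ctr P → ℕ} (hv : val P f = v)
    (h : ∀ x, (v' x : ℤ) = v x + (chi P y x - chi P (f e) x)) :
    val P (Function.update f e y) = v' := by
  funext x
  have := val_update P f e y x
  rw [hv, ← h x] at this
  exact_mod_cast this

theorem chi_eq_zero_of_not_validCtr {P : Protocol Q M} {y : CtrBase Q} (hy : ¬ ValidCtr P y)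
    (x : Ctr P) : chi P y x = 0 :=
  if_neg fun h : x.val = y => hy (h ▸ x.2)

theorem exists_token {P : Protocol Q M} {ι : Type} [Fintype ι] {f : ι → CtrBase Q}
    {y z : CtrBase Q} (hz : ValidCtr P z) (hyz : y ≠ z) {v v' : Ctr P → ℕ} (hv : val P f = v)
    (h : ∀ x, (v' x : ℤ) = v x + (chi P y x - chi P z x)) : ∃ e, f e = z := by
  have h := h ⟨z, hz⟩
  simp only [chi, if_neg hyz.symm, if_true] at h
  subst hv
  exact cnt_pos_iff.1 (show 0 < val P f ⟨z, hz⟩ by omega)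

theorem DeltaT.realizable {P : Protocol Q M} {qf : Q} (hWO : P.WaitOnly) (hqf : qf ∈ P.QA)
    {t : Q × Act M × Q} {SS SS' : Set (Summary Q)} {δ : Ctr P → ℤ} (hδ : DeltaT P t SS δ SS')
    {v v' : Ctr P → ℕ} (hv' : ∀ x, (v' x : ℤ) = v x + δ x)
    (h : Realizable P qf (.co SS, v)) : Realizable P qf (.co SS', v') := by
  classical
  obtain ⟨q, b, q', ht, hσ, y, hy, hyq, rfl, hy'⟩ := hδ.exists_replay hWO
  obtain ⟨ι, _, C, f, hr, hv, hval, hall, -⟩ := h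
  simp only [LocA.summaries] at hall
  have hq := hWO.not_isWaiting_of_send ht
  obtain ⟨e0, he0⟩ := exists_token (z := .st q) hq hyq hv hv'
  have hCe0 : C e0 = q := by simpa [he0, Allowed] using hall e0
  have : Nonempty (Q → Q) := ⟨id⟩
  choose! σ hrecv hout using hσ
  have hmove : ∀ e, ∃ p', React P b (C e) p' ∧ Allowed SS' (f e) p' := by
    intro e
    have hv := hval e
    have ha := hall e
    rcases hf : f e with p | ⟨p, k⟩ <;> rw [hf] at ha hv
    · obtain rfl : C e = p := ha
      have hp : ¬ P.isWaiting (C e) := by simpa [ValidCtr, Protocol.QA] using hv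
      exact ⟨C e, react_self_of_not_isWaiting hp b, rfl⟩
    · rcases ha with ha | ⟨S, hS, rfl, rfl, hpr⟩
      · have hp : ¬ P.isWaiting (C e) := by
          rw [ha]
          rcases hv with hv | hv
          · exact hv.1
          · simp only [CtrBase.sm.injEq] at hv
            rw [hv.1]
            exact hqf
        exact ⟨C e, react_self_of_not_isWaiting hp b, Or.inl ha⟩
      · refine ⟨σ S (C e), hrecv S hS _ hpr, ?_⟩
        have him := Set.mem_image_of_mem (σ S) hpr
        rcases hout S hS with h | ⟨S', hS', h1, h2, h3⟩
        · rw [h] at him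
          exact Or.inl him
        · exact Or.inr ⟨S', hS', h1, h2, h3 him⟩
  choose m hm hm' using hmove
  refine ⟨ι, inferInstance, Function.update m e0 q', Function.update f e0 y,
    hr.tail ⟨e0, b, by simpa [hCe0] using ht, fun e he => ?_⟩,
    val_eq_of_update hv (by rw [he0]; exact hv'), fun e => ?_, fun e => ?_, trivial⟩
  · rw [Function.update_of_ne he]
    exact hm e
  · by_cases he : e = e0
    · subst he
      simp [hy]
    · simpa [Function.update_of_ne he] using hval e
  · by_cases he : e = e0
    · subst he
      simp only [Function.update_self, LocA.summaries]
      rcases hy' with rfl | ⟨S', hS', rfl, hp⟩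
      · rfl
      · exact Or.inr ⟨S', hS', rfl, rfl, hp⟩
    · simpa [Function.update_of_ne he, LocA.summaries] using hm' e

theorem Realizable.move_token {P : Protocol Q M} {qf : Q} {l l' : LocA Q} {v v' : Ctr P → ℕ}
    {y z : CtrBase Q} (h : Realizable P qf (l, v)) (hl : l'.summaries = l.summaries)
    (hv' : ∀ x, (v' x : ℤ) = v x + (chi P y x - chi P z x))
    (hy : ValidCtr P y ∨ y = .sm qf 0)
    (hz : ∀ {ι : Type} [Fintype ι] (f : ι → CtrBase Q), val P f = v → SideCondition qf f l →
      ∃ e, f e = z)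
    (hyz : ∀ p, Allowed l.summaries z p → Allowed l.summaries y p)
    (hside : ∀ {ι : Type} (f : ι → CtrBase Q) (e : ι), f e = y → SideCondition qf f l') :
    Realizable P qf (l', v') := by
  classical
  obtain ⟨ι, _, C, f, hr, hv, hval, hall, hs⟩ := h
  simp only at hall hv
  obtain ⟨e0, he0⟩ := hz f hv hs
  refine ⟨ι, inferInstance, C, Function.update f e0 y, hr,
    val_eq_of_update hv (by rw [he0]; exact hv'), fun e => ?_, fun e => ?_,
    hside _ e0 (by simp)⟩ <;> rcases eq_or_ne e e0 with rfl | he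
  · simpa using hy
  · simpa [Function.update_of_ne he] using hval e
  · simpa [hl] using hyz _ (he0 ▸ hall e)
  · simpa [hl, Function.update_of_ne he] using hall e

theorem DeltaE.realizable {P : Protocol Q M} {qf : Q} {SS : Set (Summary Q)} {δ : Ctr P → ℤ}
    (hδ : DeltaE P SS δ) {v v' : Ctr P → ℕ} (hv' : ∀ x, (v' x : ℤ) = v x + δ x)
    (h : Realizable P qf (.co SS, v)) : Realizable P qf (.co SS, v') := by
  obtain ⟨-, q, hq, k, hk1, hk2, hlab, rfl⟩ := hδ
  refine h.move_token rfl hv' (Or.inl hq)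
    (fun f hv _ => exists_token ⟨hq, hk1, hk2⟩ (by simp) hv hv') ?_ fun _ _ _ => trivial
  rintro p (h | ⟨S, hS, rfl, rfl, -⟩)
  · exact h
  · exact absurd ⟨S, hS, rfl⟩ hlab

theorem realizable_of_step {P : Protocol Q M} {qf : Q} (hWO : P.WaitOnly) (hqf : qf ∈ P.QA)
    {c c' : LocA Q × (Ctr P → ℕ)} (hs : (VPA P qf).Step c c') (h : Realizable P qf c) :
    Realizable P qf c' := by
  classical
  have hinv : ¬ ValidCtr P (.sm qf 0) := by simp [ValidCtr]
  have hremove : ∀ {v v' : Ctr P → ℕ}, (∀ x, (v' x : ℤ) = v x + -(chi P (.st qf) x)) →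
      ∀ x, (v' x : ℤ) = v x + (chi P (.sm qf 0) x - chi P (.st qf) x) := fun h x => by
    rw [h, chi_eq_zero_of_not_validCtr hinv, zero_sub]
  obtain ⟨l, v⟩ := c
  obtain ⟨l', v'⟩ := c'
  obtain ⟨δ, hd, hv'⟩ := hs
  simp only at hd hv'
  rcases hd with h0 | h0 | h0 | h0 | h0 | h0 | ⟨t, SS, δ', SS', h0, hδ⟩ | ⟨SS, δ', h0, hδ⟩ <;>
    simp only [Prod.mk.injEq] at h0 <;> obtain ⟨rfl, rfl, rfl⟩ := h0
  · obtain ⟨ι, _, C, f, hr, hv, hval, hall, -⟩ := h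
    refine ⟨Option ι, inferInstance, addProc P.qin C, fun o => o.elim (.st P.qin) f, ?_, ?_, ?_,
      ?_, trivial⟩
    · have := hr.lift (addProc P.qin) fun _ _ h => h.addProc hWO.2.1
      convert this using 1
      funext o
      cases o <;> rfl
    · funext x
      have := val_addProc P f (.st P.qin) x
      rw [hv, ← hv' x] at this
      exact_mod_cast this
    · rintro (_ | e)
      · exact Or.inl hWO.2.1
      · exact hval e
    · rintro (_ | e)
      · rfl
      · exact hall e
  · obtain ⟨ι, _, C, f, hr, hv, hval, hall, -⟩ := h
    refine ⟨ι, inferInstance, C, f, hr, ?_, hval, hall, trivial⟩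
    funext x
    have := hv' x
    simp only [Pi.zero_apply, add_zero] at this
    rw [hv]
    exact_mod_cast this.symm
  · refine h.move_token rfl (hremove hv') (Or.inr rfl)
      (fun f hv _ => exists_token hqf (by simp) hv (hremove hv'))
      (fun p hp => Or.inl hp) fun f e he => ⟨e, he⟩
  · have hv'' : ∀ x, (v' x : ℤ) = v x + (chi P (.st qf) x - chi P (.sm qf 0) x) := fun x => by
      rw [hv', chi_eq_zero_of_not_validCtr hinv, sub_zero]
    exact h.move_token rfl hv'' (Or.inl hqf) (fun f _ hs => hs)
      (fun p hp => by simpa [Allowed, LocA.summaries] using hp) fun f e _ => ⟨e⟩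
  · refine h.move_token rfl (hremove hv') (Or.inr rfl)
      (fun f hv _ => exists_token hqf (by simp) hv (hremove hv'))
      (fun p hp => Or.inl hp) fun f e _ => ⟨e⟩
  · obtain ⟨ι, _, C, f, hr, hv, hval, hall, -⟩ := h
    refine ⟨ι, inferInstance, C, f, hr, ?_, hval, hall, trivial⟩
    funext x
    have := hv' x
    simp only [Pi.zero_apply, add_zero] at this
    rw [hv]
    exact_mod_cast this.symm
  · exact hδ.realizable hWO hqf hv' h
  · exact hδ.realizable hv' h

theorem exists_synchronizing_of_reach {P : Protocol Q M} {qf : Q} (hWO : P.WaitOnly)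
    (hqf : qf ∈ P.QA) (h : (VPA P qf).Reach (LocA.s0, 0) (LocA.sf, 0)) :
    ∃ (n : ℕ), 0 < n ∧ ∃ C C' : Fin n → Q,
      P.Initial C ∧ P.Reach C C' ∧ ∀ e, C' e = qf := by
  have hreal : Realizable P qf (LocA.sf, 0) := by
    refine Relation.ReflTransGen.head_induction_on (motive := fun c _ => Realizable P qf c →
      Realizable P qf (LocA.sf, 0)) h id (fun hs _ ih hc => ih (realizable_of_step hWO hqf hs hc))
      ⟨Empty, inferInstance, Empty.elim, Empty.elim, ?_, ?_, fun e => e.elim, fun e => e.elim,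
        trivial⟩
    · rw [show (Empty.elim : Empty → Q) = fun _ => P.qin from funext fun e => e.elim]
    · funext x
      simp [val, cnt]
  obtain ⟨ι, _, C, f, hr, hv, hval, hall, hne : Nonempty ι⟩ := hreal
  let φ := (Fintype.equivFin ι).symm
  refine ⟨Fintype.card ι, Fintype.card_pos, fun _ => P.qin, C ∘ φ, fun _ => rfl, ?_, fun e => ?_⟩
  · refine (hr.lift (fun D => D ∘ φ) fun _ _ h => ?_ :
      Relation.ReflTransGen P.StepAny ((fun _ : ι => P.qin) ∘ φ) (C ∘ φ))
    exact (stepAny_iff_stepOn P _ _).2 (h.comp_equiv φ)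
  · have h0 : f (φ e) = .sm qf 0 := (hval _).resolve_left fun hval => by
      have hpos : 0 < val P f ⟨f (φ e), hval⟩ := cnt_pos_iff.2 ⟨_, rfl⟩
      simp [hv] at hpos
    have := hall (φ e)
    rw [h0] at this
    simpa [Allowed, LocA.summaries] using this

end Soundness

section Completeness

variable {ι : Type}

/-- Data extracted from an execution that starts in `C` and ends with every process in an action
state: the goal `g e` of process `e` is its next action state, reached after `τ e` steps, and
`arr p q` is the number of steps that a canonical trajectory takes from the waiting state `p` to
the action state `q`. -/
structure IsPlan (P : Protocol Q M) (C g : ι → Q) (τ : ι → ℕ) (arr : Q → Q → ℕ) : Prop where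
  goal_eq : ∀ e, ¬ P.isWaiting (C e) → g e = C e
  delay_eq_zero : ∀ e, ¬ P.isWaiting (C e) → τ e = 0
  not_isWaiting_goal : ∀ e, ¬ P.isWaiting (g e)
  arr_pos : ∀ p q, 0 < arr p q
  arr_le : ∀ e, P.isWaiting (C e) → arr (C e) (g e) ≤ τ e

/-- Compatibility of plans for two successive configurations; `nxt p q` is the successor of `p`
on the canonical trajectory to `q`. -/
structure IsPlanStep (P : Protocol Q M) (C g : ι → Q) (τ : ι → ℕ) (arr : Q → Q → ℕ)
    (C' g' : ι → Q) (τ' : ι → ℕ) (arr' : Q → Q → ℕ) (nxt : Q → Q → Q) : Prop where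
  plan : IsPlan P C g τ arr
  plan' : IsPlan P C' g' τ' arr'
  goal : ∀ e, P.isWaiting (C e) → g e = g' e
  delay : ∀ e, P.isWaiting (C e) → τ e = τ' e + 1
  exists_rep : ∀ e, P.isWaiting (C e) → ∃ r, C r = C e ∧ g r = g e ∧ nxt (C e) (g e) = C' r
  arr_of_isWaiting : ∀ p q, P.isWaiting (nxt p q) → arr p q = arr' (nxt p q) q + 1
  arr_of_not_isWaiting : ∀ p q, ¬ P.isWaiting (nxt p q) → arr p q = 1

theorem IsPlan.exists_isPlanStep {P : Protocol Q M} {C' g' : ι → Q} {τ' : ι → ℕ}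
    {arr' : Q → Q → ℕ} (h : IsPlan P C' g' τ' arr') (C : ι → Q) :
    ∃ g τ arr nxt, IsPlanStep P C g τ arr C' g' τ' arr' nxt := by
  classical
  let g : ι → Q := fun e => if P.isWaiting (C e) then g' e else C e
  let τ : ι → ℕ := fun e => if P.isWaiting (C e) then τ' e + 1 else 0
  have hnxt : ∀ p q, ∃ x, ∀ e, C e = p → g e = q →
      ∃ r, C r = p ∧ g r = q ∧ x = C' r ∧ τ r ≤ τ e := by
    intro p q
    by_cases hne : {e | C e = p ∧ g e = q}.Nonempty
    · obtain ⟨r, ⟨hr1, hr2⟩, hr⟩ := (measure τ).wf.has_min _ hne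
      exact ⟨C' r, fun e he1 he2 => ⟨r, hr1, hr2, rfl, not_lt.1 (hr e ⟨he1, he2⟩)⟩⟩
    · exact ⟨p, fun e he1 he2 => absurd ⟨e, he1, he2⟩ hne⟩
  choose nxt hnxt using hnxt
  let arr : Q → Q → ℕ := fun p q =>
    if P.isWaiting (nxt p q) then arr' (nxt p q) q + 1 else 1
  have hg : ∀ e, P.isWaiting (C e) → g e = g' e := fun e he => if_pos he
  have hτ : ∀ e, P.isWaiting (C e) → τ e = τ' e + 1 := fun e he => if_pos he
  refine ⟨g, τ, arr, nxt, ⟨fun e he => if_neg he, fun e he => if_neg he, fun e => ?_,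
    fun p q => ?_, fun e he => ?_⟩, h, hg, hτ, fun e he => ?_, fun p q hw => if_pos hw,
    fun p q hw => if_neg hw⟩
  · by_cases he : P.isWaiting (C e)
    · rw [hg e he]
      exact h.not_isWaiting_goal e
    · simpa only [g, if_neg he] using he
  · simp only [arr]
    split_ifs <;> omega
  · obtain ⟨r, hr1, hr2, hr3, hr4⟩ := hnxt _ _ e rfl rfl
    have hrw : P.isWaiting (C r) := hr1 ▸ he
    have hτr := hτ r hrw
    simp only [arr]
    split_ifs with hw
    · rw [hr3] at hw ⊢
      have := h.arr_le r hw
      rw [← hg r hrw, hr2] at this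
      omega
    · omega
  · obtain ⟨r, hr1, hr2, hr3, -⟩ := hnxt _ _ e rfl rfl
    exact ⟨r, hr1, hr2, hr3⟩

/-- The print of `S` consists of states on canonical trajectories to the exit state of `S`, all
of which arrive after `T S.exit S.id` steps. -/
structure FollowsPlan (P : Protocol Q M) (C g : ι → Q) (arr : Q → Q → ℕ) (T : Q → ℕ → ℕ)
    (S : Summary Q) : Prop where
  valid : ValidSummary P S
  nonempty : S.pr.Nonempty
  mem : ∀ p ∈ S.pr, ∃ e, C e = p ∧ g e = S.exit
  time : ∀ p ∈ S.pr, arr p S.exit = T S.exit S.id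

/-- All summaries follow the plan, and a summary is determined by its exit state and arrival
time. -/
structure Tracks (P : Protocol Q M) (C g : ι → Q) (arr : Q → Q → ℕ) (T : Q → ℕ → ℕ)
    (SS : Set (Summary Q)) : Prop where
  follows : ∀ S ∈ SS, FollowsPlan P C g arr T S
  eq_of_time : ∀ S₁ ∈ SS, ∀ S₂ ∈ SS, S₁.exit = S₂.exit →
    T S₁.exit S₁.id = T S₂.exit S₂.id → S₁ = S₂

/-- The counter `y` is a legal place for the token of process `e`: either the process has
already reached its goal or it belongs to a summary arriving there in time. -/
def TokenOk (P : Protocol Q M) (C g : ι → Q) (τ : ι → ℕ) (T : Q → ℕ → ℕ)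
    (SS : Set (Summary Q)) (e : ι) (y : CtrBase Q) : Prop :=
  y = .st (g e) ∨
    ∃ k, P.isWaiting (C e) ∧ y = .sm (g e) k ∧ (g e, k) ∈ labs SS ∧ T (g e) k ≤ τ e

namespace Tracks

variable {P : Protocol Q M} {C g : ι → Q} {arr : Q → Q → ℕ} {T : Q → ℕ → ℕ}
  {SS : Set (Summary Q)}

theorem eq_of_label (h : Tracks P C g arr T SS) {S₁ S₂ : Summary Q} (h₁ : S₁ ∈ SS)
    (h₂ : S₂ ∈ SS) (he : S₁.exit = S₂.exit) (hi : S₁.id = S₂.id) : S₁ = S₂ :=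
  h.eq_of_time S₁ h₁ S₂ h₂ he (by rw [he, hi])

theorem eq_of_mem_pr (h : Tracks P C g arr T SS) {S₁ S₂ : Summary Q} (h₁ : S₁ ∈ SS)
    (h₂ : S₂ ∈ SS) (he : S₁.exit = S₂.exit) {p : Q} (hp₁ : p ∈ S₁.pr) (hp₂ : p ∈ S₂.pr) :
    S₁ = S₂ :=
  h.eq_of_time S₁ h₁ S₂ h₂ he <| by
    rw [← (h.follows S₁ h₁).time p hp₁, ← (h.follows S₂ h₂).time p hp₂, he]

theorem coherent (h : Tracks P C g arr T SS) : Coherent P SS := by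
  refine ⟨fun S hS => (h.follows S hS).valid, fun S₁ h₁ S₂ h₂ hne he =>
    ⟨fun hi => hne (h.eq_of_label h₁ h₂ he hi), ?_⟩⟩
  rw [Set.eq_empty_iff_forall_notMem]
  exact fun p ⟨hp₁, hp₂⟩ => hne (h.eq_of_mem_pr h₁ h₂ he hp₁ hp₂)

theorem exists_fresh_id [Finite Q] (h : Tracks P C g arr T SS) (q : Q) :
    ∃ k, 1 ≤ k ∧ k ≤ nW P + 1 ∧ (q, k) ∉ labs SS := by
  by_contra! hcon
  have hp : ∀ k, ∃ p, k ∈ Set.Icc 1 (nW P + 1) → ∃ S ∈ SS, S.exit = q ∧ S.id = k ∧ p ∈ S.pr := by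
    intro k
    by_cases hk : k ∈ Set.Icc 1 (nW P + 1)
    · obtain ⟨S, hS, hSk⟩ := hcon k hk.1 hk.2
      obtain ⟨p, hp⟩ := (h.follows S hS).nonempty
      simp only [Prod.mk.injEq] at hSk
      exact ⟨p, fun _ => ⟨S, hS, hSk.1, hSk.2, hp⟩⟩
    · exact ⟨q, fun hk' => absurd hk' hk⟩
  choose p hp using hp
  have hle := Set.ncard_le_ncard_of_injOn (s := Set.Icc 1 (nW P + 1)) (t := P.QW) p
    (fun k hk => by
      obtain ⟨S, hS, -, -, hpS⟩ := hp k hk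
      exact (h.follows S hS).valid.1 hpS)
    (fun k hk k' hk' hkk => by
      obtain ⟨S, hS, he, rfl, hpS⟩ := hp k hk
      obtain ⟨S', hS', he', rfl, hpS'⟩ := hp k' hk'
      rw [hkk] at hpS
      rw [h.eq_of_mem_pr hS hS' (he.trans he'.symm) hpS hpS'])
    (Set.toFinite _)
  rw [← Finset.coe_Icc, Set.ncard_coe_finset, Nat.card_Icc] at hle
  simp only [nW] at hle
  omega

end Tracks

theorem reach_of_release {P : Protocol Q M} {qf : Q} [Fintype ι] {SS : Set (Summary Q)}
    (hSS : Coherent P SS) {f f' : ι → CtrBase Q}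
    (h : ∀ e, f' e = f e ∨ ∃ q k, f e = .sm q k ∧ ValidCtr P (.sm q k) ∧ (q, k) ∉ labs SS ∧
      f' e = .st q) :
    (VPA P qf).Reach (.co SS, val P f) (.co SS, val P f') := by
  classical
  suffices hs : ∀ s : Finset ι, (VPA P qf).Reach (.co SS, val P f)
      (.co SS, val P fun e => if e ∈ s then f' e else f e) by
    simpa using hs Finset.univ
  intro s
  induction s using Finset.induction_on with
  | empty =>
    simp only [Finset.notMem_empty, if_false]
    exact Relation.ReflTransGen.refl
  | insert a s ha ih =>
    refine Relation.ReflTransGen.trans ih ?_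
    have hup : (fun e => if e ∈ insert a s then f' e else f e) =
        Function.update (fun e => if e ∈ s then f' e else f e) a (f' a) := by
      funext e
      rcases eq_or_ne e a with rfl | he
      · simp
      · simp [he]
    rw [hup]
    rcases h a with h | ⟨q, k, h1, ⟨hq, hk1, hk2⟩, h2, h3⟩
    · rw [Function.update_eq_self_iff.2 (by simp [ha, h])]
    · refine Relation.ReflTransGen.single ⟨_, ?_, val_update P _ a (f' a)⟩
      simp only [ha, if_false, h1, h3]
      exact Or.inr <| Or.inr <| Or.inr <| Or.inr <| Or.inr <| Or.inr <| Or.inr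
        ⟨SS, _, rfl, hSS, q, hq, k, hk1, hk2, h2, rfl⟩

/-- The summary obtained by moving each state of the print along its canonical trajectory. -/
def advance (nxt : Q → Q → Q) (S : Summary Q) : Summary Q :=
  ⟨(fun p => nxt p S.exit) '' S.pr, S.exit, S.id⟩

open Classical in
/-- As `advance`, with `none` for a summary that is done. -/
noncomputable def advanceOpt (nxt : Q → Q → Q) (T : Q → ℕ → ℕ) (S : Summary Q) :
    Option (Summary Q) :=
  if T S.exit S.id = 1 then none else some (advance nxt S)

theorem advanceOpt_eq_some_iff {nxt : Q → Q → Q} {T : Q → ℕ → ℕ} {S S' : Summary Q} :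
    advanceOpt nxt T S = some S' ↔ T S.exit S.id ≠ 1 ∧ advance nxt S = S' := by
  simp only [advanceOpt]
  split_ifs with h <;> simp [h]

namespace IsPlanStep

variable {P : Protocol Q M} {C g : ι → Q} {τ : ι → ℕ} {arr : Q → Q → ℕ}
  {C' g' : ι → Q} {τ' : ι → ℕ} {arr' : Q → Q → ℕ} {nxt : Q → Q → Q}
  {T : Q → ℕ → ℕ} {S : Summary Q} {b : M} {e₀ : ι}

theorem exists_rep_of_mem (h : IsPlanStep P C g τ arr C' g' τ' arr' nxt)
    (hS : FollowsPlan P C g arr T S) {p : Q} (hp : p ∈ S.pr) :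
    ∃ r, C r = p ∧ g' r = S.exit ∧ nxt p S.exit = C' r := by
  obtain ⟨e, rfl, he⟩ := hS.mem p hp
  have hw : P.isWaiting (C e) := hS.valid.1 hp
  obtain ⟨r, h1, h2, h3⟩ := h.exists_rep e hw
  exact ⟨r, h1, by rw [← h.goal r (h1 ▸ hw), h2, he], by rw [← he, h3]⟩

theorem time_pos (h : IsPlanStep P C g τ arr C' g' τ' arr' nxt)
    (hS : FollowsPlan P C g arr T S) : 0 < T S.exit S.id := by
  obtain ⟨p, hp⟩ := hS.nonempty
  rw [← hS.time p hp]
  exact h.plan.arr_pos _ _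

theorem isWaiting_nxt_iff (h : IsPlanStep P C g τ arr C' g' τ' arr' nxt)
    (hS : FollowsPlan P C g arr T S) {p : Q} (hp : p ∈ S.pr) :
    P.isWaiting (nxt p S.exit) ↔ T S.exit S.id ≠ 1 := by
  rw [← hS.time p hp]
  constructor
  · intro hw
    have := h.arr_of_isWaiting _ _ hw
    have := h.plan'.arr_pos (nxt p S.exit) S.exit
    omega
  · exact fun hne => by_contra fun hw => hne (h.arr_of_not_isWaiting _ _ hw)

theorem recvFun (h : IsPlanStep P C g τ arr C' g' τ' arr' nxt)
    (hS : FollowsPlan P C g arr T S) (he₀ : ¬ P.isWaiting (C e₀))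
    (hreact : ∀ e, e ≠ e₀ → React P b (C e) (C' e)) :
    RecvFun P b S.pr fun p => nxt p S.exit := by
  intro p hp
  obtain ⟨r, rfl, -, hr⟩ := h.exists_rep_of_mem hS hp
  simp only [hr]
  exact hreact r fun hr => he₀ (hr ▸ hS.valid.1 hp)

theorem image_eq_exit (h : IsPlanStep P C g τ arr C' g' τ' arr' nxt)
    (hS : FollowsPlan P C g arr T S) (hT : T S.exit S.id = 1) :
    (fun p => nxt p S.exit) '' S.pr = {S.exit} := by
  refine (hS.nonempty.image _).subset_singleton_iff.1 ?_
  rintro _ ⟨p, hp, rfl⟩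
  have hw : ¬ P.isWaiting (nxt p S.exit) := fun hw => (h.isWaiting_nxt_iff hS hp).1 hw hT
  obtain ⟨r, -, hr, hn⟩ := h.exists_rep_of_mem hS hp
  rw [hn] at hw
  simp only [Set.mem_singleton_iff]
  rw [hn, ← hr]
  exact (h.plan'.goal_eq r hw).symm

theorem followsPlan_advance (h : IsPlanStep P C g τ arr C' g' τ' arr' nxt)
    (hS : FollowsPlan P C g arr T S) (hT : T S.exit S.id ≠ 1) {T' : Q → ℕ → ℕ}
    (hT' : T' S.exit S.id = T S.exit S.id - 1) :
    FollowsPlan P C' g' arr' T' (advance nxt S) := by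
  refine ⟨⟨?_, hS.valid.2⟩, hS.nonempty.image _, ?_, ?_⟩ <;> rintro _ ⟨p, hp, rfl⟩
  · exact (h.isWaiting_nxt_iff hS hp).2 hT
  · obtain ⟨r, -, hr, hn⟩ := h.exists_rep_of_mem hS hp
    exact ⟨r, hn.symm, hr⟩
  · have := h.arr_of_isWaiting _ _ ((h.isWaiting_nxt_iff hS hp).2 hT)
    rw [hS.time p hp] at this
    simp only [advance, hT']
    omega

theorem stepsTo_advanceOpt (h : IsPlanStep P C g τ arr C' g' τ' arr' nxt)
    (hS : FollowsPlan P C g arr T S) (ht : (C e₀, Act.send b, C' e₀) ∈ P.T)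
    (he₀ : ¬ P.isWaiting (C e₀)) (hreact : ∀ e, e ≠ e₀ → React P b (C e) (C' e)) :
    stepsTo P (C e₀, Act.send b, C' e₀) S (advanceOpt nxt T S) := by
  simp only [advanceOpt]
  split_ifs with hT
  · exact ⟨_, _, _, rfl, ht, _, h.recvFun hS he₀ hreact, h.image_eq_exit hS hT⟩
  · exact ⟨_, _, _, rfl, ht, _, h.recvFun hS he₀ hreact, rfl, rfl, rfl,
      (h.followsPlan_advance (T' := fun q k => T q k - 1) hS hT rfl).valid.1⟩

variable [Fintype ι] {SS SS' : Set (Summary Q)} {T' : Q → ℕ → ℕ} {f : ι → CtrBase Q}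
  {y : CtrBase Q} {qf : Q}

theorem exists_reach_of_deltaT (h : IsPlanStep P C g τ arr C' g' τ' arr' nxt)
    (hSS : Tracks P C g arr T SS) (hf : ∀ e, TokenOk P C g τ T SS e (f e))
    (he₀ : ¬ P.isWaiting (C e₀)) (hreact : ∀ e, e ≠ e₀ → React P b (C e) (C' e))
    (hδ : DeltaT P (C e₀, Act.send b, C' e₀) SS
      (fun x => chi P y x - chi P (.st (C e₀)) x) SS')
    (hy : TokenOk P C' g' τ' T' SS' e₀ y)
    (hgo : ∀ S ∈ SS, T S.exit S.id ≠ 1 →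
      (S.exit, S.id) ∈ labs SS' ∧ T' S.exit S.id = T S.exit S.id - 1)
    (hdone : ∀ S ∈ SS, T S.exit S.id = 1 → (S.exit, S.id) ∉ labs SS') :
    ∃ f', (∀ e, TokenOk P C' g' τ' T' SS' e (f' e)) ∧
      (VPA P qf).Reach (.co SS, val P f) (.co SS', val P f') := by
  classical
  have hstep : (VPA P qf).Step (.co SS, val P f) (.co SS', val P (Function.update f e₀ y)) := by
    refine ⟨_, ?_, val_update P f e₀ y⟩
    have hfe : f e₀ = .st (C e₀) := by
      rcases hf e₀ with h0 | ⟨k, hw, -⟩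
      · rw [h0, h.plan.goal_eq e₀ he₀]
      · exact absurd hw he₀
    rw [hfe]
    exact Or.inr <| Or.inr <| Or.inr <| Or.inr <| Or.inr <| Or.inr <| Or.inl
      ⟨_, SS, _, SS', rfl, hδ⟩
  have hrel : ∀ e, ∃ z, TokenOk P C' g' τ' T' SS' e z ∧
      (z = Function.update f e₀ y e ∨ ∃ q k, Function.update f e₀ y e = .sm q k ∧
        ValidCtr P (.sm q k) ∧ (q, k) ∉ labs SS' ∧ z = .st q) := by
    intro e
    rcases eq_or_ne e e₀ with rfl | he
    · exact ⟨y, hy, Or.inl (by simp)⟩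
    simp only [Function.update_of_ne he]
    have hg : g e = g' e := by
      by_cases hw : P.isWaiting (C e)
      · exact h.goal e hw
      · have hCe := (hreact e he).eq_of_not_isWaiting hw
        rw [h.plan.goal_eq e hw, h.plan'.goal_eq e (hCe ▸ hw), hCe]
    rcases hf e with h0 | ⟨k, hw, h0, ⟨S, hS, hlab⟩, hk⟩
    · exact ⟨f e, Or.inl (by rw [h0, hg]), Or.inl rfl⟩
    simp only [Prod.mk.injEq] at hlab
    obtain ⟨hl1, rfl⟩ := hlab
    have hv := hSS.follows S hS
    by_cases hT : T S.exit S.id = 1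
    · refine ⟨.st (g' e), Or.inl rfl, Or.inr ⟨S.exit, S.id, by rw [h0, hl1], hv.valid.2,
        hdone S hS hT, by rw [hl1, hg]⟩⟩
    · obtain ⟨hlab, hT'⟩ := hgo S hS hT
      have hpos := h.time_pos hv
      have hd := h.delay e hw
      rw [hl1] at hlab hT' hpos hT
      rw [hg] at h0 hk hlab hT' hpos hT
      refine ⟨f e, Or.inr ⟨S.id, ?_, h0, hlab, by omega⟩, Or.inl rfl⟩
      by_contra hw'
      have := h.plan'.delay_eq_zero e hw'
      omega
  choose f' hf' hff using hrel
  exact ⟨f', hf', (Relation.ReflTransGen.single hstep).trans (reach_of_release hδ.2.1 hff)⟩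

theorem exists_reach [Finite Q] (h : IsPlanStep P C g τ arr C' g' τ' arr' nxt)
    (hWO : P.WaitOnly) (hs : StepOn P C C') (hSS : Tracks P C g arr T SS)
    (hf : ∀ e, TokenOk P C g τ T SS e (f e)) :
    ∃ SS' T' f', Tracks P C' g' arr' T' SS' ∧ (∀ e, TokenOk P C' g' τ' T' SS' e (f' e)) ∧
      (VPA P qf).Reach (.co SS, val P f) (.co SS', val P f') := by
  classical
  obtain ⟨e₀, b, ht, hreact⟩ := hs
  have he₀ := hWO.not_isWaiting_of_send ht
  have hsteps : ∀ S ∈ SS, stepsTo P (C e₀, Act.send b, C' e₀) S (advanceOpt nxt T S) :=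
    fun S hS => h.stepsTo_advanceOpt (hSS.follows S hS) ht he₀ hreact
  have hpos : ∀ S ∈ SS, 0 < T S.exit S.id := fun S hS => h.time_pos (hSS.follows S hS)
  by_cases hw : P.isWaiting (C' e₀)
  swap
  · have htr : Tracks P C' g' arr' (fun q k => T q k - 1)
        {S' | ∃ S ∈ SS, advanceOpt nxt T S = some S'} := by
      constructor
      · rintro _ ⟨S, hS, hadv⟩
        obtain ⟨hT, rfl⟩ := advanceOpt_eq_some_iff.1 hadv
        exact h.followsPlan_advance (hSS.follows S hS) hT rfl
      · rintro _ ⟨S₁, hS₁, hadv₁⟩ _ ⟨S₂, hS₂, hadv₂⟩ he hT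
        obtain ⟨hT₁, rfl⟩ := advanceOpt_eq_some_iff.1 hadv₁
        obtain ⟨hT₂, rfl⟩ := advanceOpt_eq_some_iff.1 hadv₂
        have := hpos S₁ hS₁
        have := hpos S₂ hS₂
        simp only [advance] at he hT
        rw [hSS.eq_of_time S₁ hS₁ S₂ hS₂ he (by omega)]
    obtain ⟨f', hf', hr⟩ := h.exists_reach_of_deltaT (qf := qf) hSS hf he₀ hreact
      (y := .st (C' e₀)) (T' := fun q k => T q k - 1)
      ⟨hSS.coherent, htr.coherent, _, _, _, rfl, ht, Or.inl ⟨hw, ⟨_, hsteps, rfl⟩, rfl⟩⟩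
      (Or.inl (by rw [h.plan'.goal_eq e₀ hw]))
      (fun S hS hT => ⟨⟨advance nxt S, ⟨S, hS, advanceOpt_eq_some_iff.2 ⟨hT, rfl⟩⟩, rfl⟩, rfl⟩)
      (by
        rintro S hS hT ⟨_, ⟨S', hS', hadv⟩, hlab⟩
        obtain ⟨hT', rfl⟩ := advanceOpt_eq_some_iff.1 hadv
        simp only [advance, Prod.mk.injEq] at hlab
        rw [hlab.1, hlab.2] at hT'
        exact hT' hT)
    exact ⟨_, _, f', htr, hf', hr⟩
  by_cases hj : ∃ S₀ ∈ SS, S₀.exit = g' e₀ ∧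
      T S₀.exit S₀.id = arr' (C' e₀) (g' e₀) + 1
  · obtain ⟨S₀, hS₀, hexit, htime⟩ := hj
    have hfo₀ := hSS.follows S₀ hS₀
    have harr := h.plan'.arr_pos (C' e₀) (g' e₀)
    have hT₀ : T S₀.exit S₀.id ≠ 1 := by omega
    have hadv₀ := h.followsPlan_advance (T' := fun q k => T q k - 1) hfo₀ hT₀ rfl
    let S₀' : Summary Q := ⟨(fun p => nxt p S₀.exit) '' S₀.pr ∪ {C' e₀}, S₀.exit, S₀.id⟩
    have hfo : FollowsPlan P C' g' arr' (fun q k => T q k - 1) S₀' := by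
      refine ⟨⟨?_, hfo₀.valid.2⟩, ⟨C' e₀, Or.inr rfl⟩, ?_, ?_⟩
      · rintro p (hp | rfl)
        · exact hadv₀.valid.1 hp
        · exact hw
      · rintro p (hp | rfl)
        · exact hadv₀.mem p hp
        · exact ⟨e₀, rfl, hexit.symm⟩
      · rintro p (hp | rfl)
        · exact hadv₀.time p hp
        · simp only [S₀']
          rw [htime, hexit]
          rfl
    have hmem : ∀ {S'}, S' ∈ insert S₀' {S' | ∃ S ∈ SS, S ≠ S₀ ∧ advanceOpt nxt T S = some S'} →
        FollowsPlan P C' g' arr' (fun q k => T q k - 1) S' ∧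
        ∃ S ∈ SS, T S.exit S.id ≠ 1 ∧ S'.exit = S.exit ∧ S'.id = S.id ∧
          S' = if S = S₀ then S₀' else advance nxt S := by
      rintro S' (rfl | ⟨S, hS, hne, hadv⟩)
      · exact ⟨hfo, S₀, hS₀, hT₀, rfl, rfl, by simp⟩
      · obtain ⟨hT, rfl⟩ := advanceOpt_eq_some_iff.1 hadv
        exact ⟨h.followsPlan_advance (hSS.follows S hS) hT rfl, S, hS, hT, rfl, rfl,
          by simp [hne]⟩
    have htr : Tracks P C' g' arr' (fun q k => T q k - 1)
        (insert S₀' {S' | ∃ S ∈ SS, S ≠ S₀ ∧ advanceOpt nxt T S = some S'}) := by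
      refine ⟨fun S' hS' => (hmem hS').1, fun S₁' hS₁' S₂' hS₂' he hT => ?_⟩
      obtain ⟨-, S₁, hS₁, hT₁, he₁, hi₁, h₁⟩ := hmem hS₁'
      obtain ⟨-, S₂, hS₂, hT₂, he₂, hi₂, h₂⟩ := hmem hS₂'
      have := hpos S₁ hS₁
      have := hpos S₂ hS₂
      rw [he₁, he₂] at he
      simp only [he₁, he₂, hi₁, hi₂] at hT
      rw [h₁, h₂, hSS.eq_of_time S₁ hS₁ S₂ hS₂ he (by omega)]
    have hlabs : ∀ S ∈ SS, T S.exit S.id ≠ 1 → (S.exit, S.id) ∈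
        labs (insert S₀' {S' | ∃ S ∈ SS, S ≠ S₀ ∧ advanceOpt nxt T S = some S'}) := by
      intro S hS hT
      rcases eq_or_ne S S₀ with rfl | hne
      · exact ⟨S₀', Set.mem_insert _ _, rfl⟩
      · exact ⟨advance nxt S, Set.mem_insert_of_mem _
          ⟨S, hS, hne, advanceOpt_eq_some_iff.2 ⟨hT, rfl⟩⟩, rfl⟩
    obtain ⟨f', hf', hr⟩ := h.exists_reach_of_deltaT (qf := qf) hSS hf he₀ hreact
      (y := .sm S₀.exit S₀.id) (T' := fun q k => T q k - 1)
      ⟨hSS.coherent, htr.coherent, _, _, _, rfl, ht, Or.inr <| Or.inl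
        ⟨hw, S₀, hS₀, S₀', ⟨_, _, _, rfl, ht, hw, _, h.recvFun hfo₀ he₀ hreact, rfl, rfl, rfl,
          hfo.valid.1⟩, ⟨_, fun S hS _ => hsteps S hS, rfl⟩, rfl⟩⟩
      (Or.inr ⟨S₀.id, hw, by rw [hexit], hexit ▸ hlabs S₀ hS₀ hT₀, by
        have := h.plan'.arr_le e₀ hw
        rw [hexit] at htime
        simp only
        omega⟩)
      (fun S hS hT => ⟨hlabs S hS hT, rfl⟩)
      (by
        rintro S hS hT ⟨S', hS', hlab⟩
        obtain ⟨-, S₁, hS₁, hT₁, he₁, hi₁, -⟩ := hmem hS'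
        simp only [he₁, hi₁, Prod.mk.injEq] at hlab
        rw [hlab.1, hlab.2] at hT₁
        exact hT₁ hT)
    exact ⟨_, _, f', htr, hf', hr⟩
  · push Not at hj
    obtain ⟨k, hk1, hk2, hk⟩ := hSS.exists_fresh_id (g' e₀)
    let T' : Q → ℕ → ℕ := fun q i =>
      if q = g' e₀ ∧ i = k then arr' (C' e₀) (g' e₀) else T q i - 1
    have hTold : ∀ S ∈ SS, T' S.exit S.id = T S.exit S.id - 1 := by
      refine fun S hS => if_neg ?_
      rintro ⟨h1, h2⟩
      exact hk ⟨S, hS, Prod.ext h1 h2⟩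
    have hTnew : T' (g' e₀) k = arr' (C' e₀) (g' e₀) := if_pos ⟨rfl, rfl⟩
    have hsep : ∀ S ∈ SS, T S.exit S.id ≠ 1 → S.exit = g' e₀ →
        T' S.exit S.id ≠ T' (g' e₀) k := by
      intro S hS hT he
      have := hj S hS he
      have := hpos S hS
      rw [hTold S hS, hTnew]
      omega
    have htr : Tracks P C' g' arr' T' (insert ⟨{C' e₀}, g' e₀, k⟩
        {S' | ∃ S ∈ SS, advanceOpt nxt T S = some S'}) := by
      constructor
      · rintro _ (rfl | ⟨S, hS, hadv⟩)
        · refine ⟨⟨?_, h.plan'.not_isWaiting_goal e₀, hk1, hk2⟩, ⟨C' e₀, rfl⟩, ?_, ?_⟩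
          · rintro _ rfl
            exact hw
          · rintro _ rfl
            exact ⟨e₀, rfl, rfl⟩
          · rintro _ rfl
            exact hTnew.symm
        · obtain ⟨hT, rfl⟩ := advanceOpt_eq_some_iff.1 hadv
          exact h.followsPlan_advance (hSS.follows S hS) hT (hTold S hS)
      · rintro _ (rfl | ⟨S₁, hS₁, hadv₁⟩) _ (rfl | ⟨S₂, hS₂, hadv₂⟩) he hT
        · rfl
        · obtain ⟨hT₂, rfl⟩ := advanceOpt_eq_some_iff.1 hadv₂
          exact absurd hT.symm (hsep S₂ hS₂ hT₂ he.symm)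
        · obtain ⟨hT₁, rfl⟩ := advanceOpt_eq_some_iff.1 hadv₁
          exact absurd hT (hsep S₁ hS₁ hT₁ he)
        · obtain ⟨hT₁, rfl⟩ := advanceOpt_eq_some_iff.1 hadv₁
          obtain ⟨hT₂, rfl⟩ := advanceOpt_eq_some_iff.1 hadv₂
          have := hpos S₁ hS₁
          have := hpos S₂ hS₂
          simp only [advance] at he hT
          rw [hTold S₁ hS₁, hTold S₂ hS₂] at hT
          rw [hSS.eq_of_time S₁ hS₁ S₂ hS₂ he (by omega)]
    obtain ⟨f', hf', hr⟩ := h.exists_reach_of_deltaT (qf := qf) hSS hf he₀ hreact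
      (y := .sm (g' e₀) k) (T' := T')
      ⟨hSS.coherent, htr.coherent, _, _, _, rfl, ht, Or.inr <| Or.inr
        ⟨hw, g' e₀, h.plan'.not_isWaiting_goal e₀, k, hk1, hk2, hk, ⟨_, hsteps, rfl⟩, rfl⟩⟩
      (Or.inr ⟨k, hw, rfl, ⟨_, Set.mem_insert _ _, rfl⟩, hTnew.trans_le (h.plan'.arr_le e₀ hw)⟩)
      (fun S hS hT => ⟨⟨advance nxt S, Set.mem_insert_of_mem _
        ⟨S, hS, advanceOpt_eq_some_iff.2 ⟨hT, rfl⟩⟩, rfl⟩, hTold S hS⟩)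
      (by
        rintro S hS hT ⟨_, (rfl | ⟨S', hS', hadv⟩), hlab⟩
        · exact hk ⟨S, hS, hlab.symm⟩
        · obtain ⟨hT', rfl⟩ := advanceOpt_eq_some_iff.1 hadv
          simp only [advance, Prod.mk.injEq] at hlab
          rw [hlab.1, hlab.2] at hT'
          exact hT' hT)
    exact ⟨_, _, f', htr, hf', hr⟩

end IsPlanStep

theorem exists_isPlan_of_reach [Finite Q] [Fintype ι] {P : Protocol Q M} {qf : Q}
    (hWO : P.WaitOnly) (hqf : qf ∈ P.QA) {C : ι → Q}
    (h : Relation.ReflTransGen (StepOn P) C fun _ => qf) :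
    ∃ g τ arr, IsPlan P C g τ arr ∧ ∀ SS T f, Tracks P C g arr T SS →
      (∀ e, TokenOk P C g τ T SS e (f e)) →
      (VPA P qf).Reach (.co SS, val P f) (.co ∅, val P fun _ : ι => .st qf) := by
  induction h using Relation.ReflTransGen.head_induction_on with
  | refl =>
    refine ⟨fun _ => qf, fun _ => 0, fun _ _ => 1, ⟨fun _ _ => rfl, fun _ _ => rfl,
      fun _ => hqf, fun _ _ => one_pos, fun _ he => absurd he hqf⟩, fun SS T f hSS hf => ?_⟩
    have hempty : SS = ∅ := by
      refine Set.eq_empty_of_forall_notMem fun S hS => ?_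
      have hfo := hSS.follows S hS
      obtain ⟨p, hp⟩ := hfo.nonempty
      obtain ⟨e, rfl, -⟩ := hfo.mem p hp
      exact hqf (hfo.valid.1 hp)
    have hst : f = fun _ => .st qf := by
      funext e
      exact (hf e).resolve_right fun ⟨k, hw, _⟩ => hqf hw
    rw [hempty, hst]
    exact Relation.ReflTransGen.refl
  | head hs _ ih =>
    obtain ⟨g', τ', arr', hplan, hreach⟩ := ih
    obtain ⟨g, τ, arr, nxt, hstep⟩ := hplan.exists_isPlanStep _
    refine ⟨g, τ, arr, hstep.plan, fun SS T f hSS hf => ?_⟩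
    obtain ⟨SS', T', f', hSS', hf', hr⟩ := hstep.exists_reach (qf := qf) hWO hs hSS hf
    exact hr.trans (hreach SS' T' f' hSS' hf')

theorem val_const_succ (P : Protocol Q M) (n : ℕ) (y : CtrBase Q) (x : Ctr P) :
    (val P (fun _ : Fin (n + 1) => y) x : ℤ) = val P (fun _ : Fin n => y) x + chi P y x := by
  classical
  simp only [val, cnt, chi, Fin.sum_univ_succ, eq_comm (b := x.val)]
  push_cast
  ring

theorem val_fin_zero (P : Protocol Q M) (y : CtrBase Q) : val P (fun _ : Fin 0 => y) = 0 := by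
  funext x
  simp [val, cnt]

theorem reach_s0 (P : Protocol Q M) (qf : Q) (n : ℕ) :
    (VPA P qf).Reach (.s0, 0) (.s0, val P fun _ : Fin n => .st P.qin) := by
  induction n with
  | zero =>
    rw [val_fin_zero]
    exact Relation.ReflTransGen.refl
  | succ n ih => exact ih.tail ⟨_, Or.inl rfl, val_const_succ P n _⟩

theorem reach_sf (P : Protocol Q M) (qf : Q) (n : ℕ) :
    (VPA P qf).Reach (.sf, val P fun _ : Fin n => .st qf) (.sf, 0) := by
  induction n with
  | zero =>
    rw [val_fin_zero]
    exact Relation.ReflTransGen.refl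
  | succ n ih =>
    refine ih.head ⟨_, Or.inr <| Or.inr <| Or.inr <| Or.inr <| Or.inl rfl, fun x => ?_⟩
    simp only [val_const_succ]
    ring

theorem reach_of_synchronizing [Finite Q] {P : Protocol Q M} {qf : Q} (hWO : P.WaitOnly)
    (hqf : qf ∈ P.QA) {n : ℕ} (hn : 0 < n) {C C' : Fin n → Q} (hC : P.Initial C)
    (hr : P.Reach C C') (hC' : ∀ e, C' e = qf) :
    (VPA P qf).Reach (LocA.s0, 0) (LocA.sf, 0) := by
  obtain rfl : C = fun _ => P.qin := funext hC
  obtain rfl : C' = fun _ => qf := funext hC'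
  have hr' : Relation.ReflTransGen (StepOn P) (fun _ : Fin n => P.qin) fun _ => qf :=
    Relation.ReflTransGen.mono (fun _ _ => (stepAny_iff_stepOn P _ _).1) _ _ hr
  obtain ⟨g, τ, arr, hplan, hreach⟩ := exists_isPlan_of_reach hWO hqf hr'
  have hmid := hreach ∅ (fun _ _ => 0) (fun _ => .st P.qin) ⟨by simp, by simp⟩
    fun e => Or.inl (by rw [hplan.goal_eq e hWO.2.1])
  obtain ⟨m, rfl⟩ := Nat.exists_eq_succ_of_ne_zero hn.ne'
  refine Relation.ReflTransGen.trans (reach_s0 P qf (m + 1)) <|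
    Relation.ReflTransGen.head ⟨_, Or.inr (Or.inl rfl), by simp⟩ <|
    hmid.trans <| Relation.ReflTransGen.head
      (b := (LocA.sf', val P fun _ : Fin m => .st qf))
      ⟨_, Or.inr <| Or.inr <| Or.inl rfl, fun x => ?_⟩ <|
    Relation.ReflTransGen.head ⟨_, Or.inr <| Or.inr <| Or.inr <| Or.inl rfl,
      val_const_succ P m _⟩ (reach_sf P qf (m + 1))
  simp only [Nat.succ_eq_add_one, val_const_succ]
  ring

end Completeness

end BP

open BP in
/-- **Synchronization in an action state vs mutual reachability.** For a Wait-Only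
protocol with final action state `q_f`, all processes can gather in `q_f` iff in the
modified VASS `V_P` there is a run from `(s_0,0)` to `(s_f,0)` and a run from `(s_f,0)`
back to `(s_0,0)`. -/
theorem synchro_action_iff_mutual_reach {Q M : Type} [Fintype Q] [Fintype M]
    (P : Protocol Q M) (qu qf : Q)
    (hWO : P.WaitOnly) (hqu : P.Uncoverable qu) (hqf : qf ∈ P.QA) :
    (∃ (n : ℕ), 0 < n ∧ ∃ C C' : Fin n → Q,
       P.Initial C ∧ P.Reach C C' ∧ ∀ e, C' e = qf) ↔
    ((VPA P qf).Reach (LocA.s0, 0) (LocA.sf, 0) ∧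
     (VPA P qf).Reach (LocA.sf, 0) (LocA.s0, 0)) := by
  constructor
  · rintro ⟨n, hn, C, C', hC, hr, hC'⟩
    exact ⟨reach_of_synchronizing hWO hqf hn hC hr hC', Relation.ReflTransGen.single
      ⟨0, Or.inr <| Or.inr <| Or.inr <| Or.inr <| Or.inr <| Or.inl rfl, by simp⟩⟩
  · exact fun h => exists_synchronizing_of_reach hWO hqf h.1
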